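/- There exists an infinite binary word w that is (2+α)⁺-free, where α = (1+√5)/2 is the golden ratio, such that the set of nonempty binary words x for which both x and its complement x̄ are factors of w has at most 4 elements. -/

import Mathlib

/-- `x` occurs as a contiguous block in the infinite word `w : ℕ → α`. -/
def FactorN {α : Type*} (w : ℕ → α) (x : List α) : Prop :=
  ∃ i : ℕ, x = (List.range x.length).map fun k => w (i + k)

/-- the finite word `u` has period `p ≥ 1`. -/
def HasPeriod {α : Type*} (u : List α) (p : ℕ) : Prop :=
  1 ≤ p ∧ ∀ i : ℕ, i + p < u.length → u[i]? = u[i + p]?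

/-- the smallest period of `u`. -/
noncomputable def minPeriod {α : Type*} (u : List α) : ℕ :=
  sInf {p | HasPeriod u p}

/-- the exponent of `u`: its length divided by its smallest period. -/
noncomputable def expo {α : Type*} (u : List α) : ℝ :=
  (u.length : ℝ) / (minPeriod u : ℝ)

/-- the complement of a binary word: each letter is flipped. -/
def comp (x : List Bool) : List Bool := x.map fun b => !b

/-- The slope `1 / (2 + φ) = [0; 3, 1, 1, 1, …]`. -/
noncomputable def goldenSlope : ℝ := (5 - Real.sqrt 5) / 10

/-- The inverse of the golden ratio. -/
noncomputable def invGolden : ℝ := (Real.sqrt 5 - 1) / 2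

/-- Denominators of the convergents of `goldenSlope`: `1, 3, 4, 7, 11, …`. -/
def convDen (k : ℕ) : ℕ := Nat.fib k + Nat.fib (k + 2)

/-- The number of ones among the first `n` letters of `sturmianWord`. -/
noncomputable def onesBefore (n : ℕ) : ℤ := ⌊(n : ℝ) * goldenSlope⌋

/-- The mechanical word of slope `goldenSlope` and intercept `0`. -/
noncomputable def sturmianWord (n : ℕ) : Bool := decide (onesBefore (n + 1) ≠ onesBefore n)

lemma sqrt_five_sq : Real.sqrt 5 * Real.sqrt 5 = 5 := Real.mul_self_sqrt (by norm_num)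

lemma sqrt_five_gt : (2.236 : ℝ) < Real.sqrt 5 := Real.lt_sqrt_of_sq_lt (by norm_num)

lemma sqrt_five_lt : Real.sqrt 5 < (2.237 : ℝ) :=
  (Real.sqrt_lt' (by norm_num)).2 (by norm_num)

lemma goldenSlope_pos : 0 < goldenSlope := by
  unfold goldenSlope; linarith [sqrt_five_lt]

lemma three_goldenSlope_lt : 3 * goldenSlope < 1 := by
  unfold goldenSlope; linarith [sqrt_five_gt]

lemma one_lt_four_goldenSlope : 1 < 4 * goldenSlope := by
  unfold goldenSlope; linarith [sqrt_five_lt]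

lemma invGolden_pos : 0 < invGolden := by
  unfold invGolden; linarith [sqrt_five_gt]

lemma invGolden_lt_one : invGolden < 1 := by
  unfold invGolden; linarith [sqrt_five_lt]

lemma invGolden_sq : invGolden * invGolden = 1 - invGolden := by
  unfold invGolden; nlinarith [sqrt_five_sq]

lemma goldenSlope_mul_invGolden : goldenSlope * invGolden = 1 - 3 * goldenSlope := by
  unfold invGolden goldenSlope; nlinarith [sqrt_five_sq]

lemma convDen_add_two (k : ℕ) : convDen (k + 2) = convDen k + convDen (k + 1) := by
  unfold convDen
  have h1 : Nat.fib (k + 2) = Nat.fib k + Nat.fib (k + 1) := Nat.fib_add_two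
  have h2 : Nat.fib (k + 2 + 2) = Nat.fib (k + 2) + Nat.fib (k + 2 + 1) := Nat.fib_add_two
  rw [h2, show k + 1 + 2 = k + 2 + 1 from rfl]
  omega

lemma convDen_pos (k : ℕ) : 0 < convDen k := by
  unfold convDen
  have := Nat.fib_pos.2 (show 0 < k + 2 by omega)
  omega

lemma lt_convDen_succ (k : ℕ) : k < convDen (k + 1) := by
  induction k with
  | zero => exact convDen_pos 1
  | succ k ih =>
    rw [convDen_add_two]
    have := convDen_pos k
    omega

/-- The approximation error of the `k`-th convergent. -/
lemma convDen_mul_goldenSlope (k : ℕ) :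
    (convDen k : ℝ) * goldenSlope - Nat.fib k = goldenSlope * (-invGolden) ^ k := by
  induction k using Nat.twoStepInduction with
  | zero => simp [convDen]
  | one =>
    have : convDen 1 = 3 := rfl
    rw [this]
    have := goldenSlope_mul_invGolden
    push_cast [Nat.fib_one]
    linarith
  | more k ih1 ih2 =>
    rw [convDen_add_two, Nat.fib_add_two]
    push_cast
    have : (-invGolden) ^ (k + 2) = (-invGolden) ^ k + (-invGolden) ^ (k + 1) := by
      rw [pow_succ, pow_succ]
      linear_combination (-invGolden) ^ k * invGolden_sq
    rw [this]
    linear_combination ih1 + ih2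

/-- Consecutive convergents form a unimodular pair. -/
lemma convDen_unimodular (k : ℕ) :
    (convDen k : ℤ) * Nat.fib (k + 1) - convDen (k + 1) * Nat.fib k = (-1) ^ k := by
  induction k with
  | zero => simp [convDen]
  | succ k ih =>
    rw [convDen_add_two, Nat.fib_add_two, pow_succ]
    push_cast
    linear_combination -ih

/-- Every window of `convDen (k + 2)` rotation points meets every half-open interval
of length `goldenSlope * invGolden ^ k` modulo one. -/
lemma exists_rotation_mem (k : ℕ) (y : ℝ) :
    ∃ i : ℕ, i < convDen (k + 2) ∧ ∃ m : ℤ,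
      0 ≤ i * goldenSlope + y - m ∧ i * goldenSlope + y - m < goldenSlope * invGolden ^ k := by
  induction k generalizing y with
  | zero =>
    have h4 : convDen (0 + 2) = 4 := rfl
    rw [h4]
    have f0 := Int.floor_le y
    have f1 := Int.lt_floor_add_one y
    have s4 := one_lt_four_goldenSlope
    have s0 := goldenSlope_pos
    by_cases c0 : y - ⌊y⌋ < goldenSlope
    · exact ⟨0, by norm_num, ⌊y⌋, by push_cast; linarith, by push_cast; linarith⟩
    by_cases c1 : 1 ≤ y - ⌊y⌋ + goldenSlope
    · exact ⟨1, by norm_num, ⌊y⌋ + 1, by push_cast; linarith, by push_cast; linarith⟩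
    by_cases c2 : 1 ≤ y - ⌊y⌋ + 2 * goldenSlope
    · exact ⟨2, by norm_num, ⌊y⌋ + 1, by push_cast; linarith, by push_cast; linarith⟩
    · exact ⟨3, by norm_num, ⌊y⌋ + 1, by push_cast; linarith, by push_cast; linarith⟩
  | succ k ih =>
    have hpow : 0 < goldenSlope * invGolden ^ k := mul_pos goldenSlope_pos (pow_pos invGolden_pos k)
    have hpow1 : 0 < goldenSlope * invGolden ^ (k + 1) :=
      mul_pos goldenSlope_pos (pow_pos invGolden_pos (k + 1))
    have hsum : goldenSlope * invGolden ^ k ≤ 2 * (goldenSlope * invGolden ^ (k + 1)) := by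
      have : (1 : ℝ) ≤ 2 * invGolden := by unfold invGolden; linarith [sqrt_five_gt]
      rw [pow_succ]; nlinarith
    have hlt : goldenSlope * invGolden ^ (k + 1) ≤ goldenSlope * invGolden ^ k := by
      rw [pow_succ]; nlinarith [invGolden_lt_one]
    have herr := convDen_mul_goldenSlope (k + 1)
    have hden : convDen (k + 1 + 2) = convDen (k + 1) + convDen (k + 2) := convDen_add_two (k + 1)
    rcases Nat.even_or_odd (k + 1) with hk | hk
    · rw [hk.neg_pow] at herr
      obtain ⟨i, hi, m, h0, h1⟩ :=
        ih (y + (goldenSlope * invGolden ^ k - goldenSlope * invGolden ^ (k + 1)))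
      by_cases c : 0 ≤ i * goldenSlope + y - m
      · exact ⟨i, by omega, m, c, by linarith⟩
      · refine ⟨i + convDen (k + 1), by omega, m + Nat.fib (k + 1), ?_, ?_⟩ <;>
          push_cast <;> linarith
    · rw [hk.neg_pow] at herr
      obtain ⟨i, hi, m, h0, h1⟩ := ih y
      by_cases c : i * goldenSlope + y - m < goldenSlope * invGolden ^ (k + 1)
      · exact ⟨i, by omega, m, h0, c⟩
      · refine ⟨i + convDen (k + 1), by omega, m + Nat.fib (k + 1), ?_, ?_⟩ <;>
          push_cast <;> linarith

/-- Best approximation property of the convergents. -/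
lemma best_approximation (k p : ℕ) (hp : 0 < p) (hlt : p < convDen (k + 1)) (m : ℤ) :
    goldenSlope * invGolden ^ k ≤ |(p : ℝ) * goldenSlope - m| := by
  obtain ⟨a, b, ha, hb⟩ : ∃ a b : ℤ, (p : ℤ) = a * convDen k + b * convDen (k + 1) ∧
      m = a * Nat.fib k + b * Nat.fib (k + 1) := by
    have hu := convDen_unimodular k
    have hs : ((-1 : ℤ) ^ k) * (-1) ^ k = 1 := by rw [← mul_pow]; simp
    refine ⟨(-1) ^ k * (p * Nat.fib (k + 1) - m * convDen (k + 1)),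
      (-1) ^ k * (m * convDen k - p * Nat.fib k), ?_, ?_⟩
    · linear_combination (-(p : ℤ)) * hs - (-1) ^ k * p * hu
    · linear_combination (-m) * hs - (-1) ^ k * m * hu
  have hη : 0 < goldenSlope * invGolden ^ k := mul_pos goldenSlope_pos (pow_pos invGolden_pos k)
  have hval : (p : ℝ) * goldenSlope - m =
      goldenSlope * (-invGolden) ^ k * (a - b * invGolden) := by
    have ha' : (p : ℝ) = a * convDen k + b * convDen (k + 1) := by exact_mod_cast ha
    have hb' : (m : ℝ) = a * Nat.fib k + b * Nat.fib (k + 1) := by exact_mod_cast hb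
    rw [ha', hb']
    have h1 := convDen_mul_goldenSlope k
    have h2 := convDen_mul_goldenSlope (k + 1)
    rw [pow_succ] at h2
    linear_combination (a : ℝ) * h1 + (b : ℝ) * h2
  have hq := convDen_pos k
  have hq1 := convDen_pos (k + 1)
  have hcoef : (1 : ℝ) ≤ |(a : ℝ) - b * invGolden| := by
    have ht := invGolden_pos
    rcases lt_trichotomy a 0 with h | h | h
    · have hb0 : 0 ≤ b := by
        by_contra hcon
        push Not at hcon
        have h1 : a * convDen k < 0 := mul_neg_of_neg_of_pos h (by exact_mod_cast hq)
        have h2 : b * convDen (k + 1) < 0 := mul_neg_of_neg_of_pos hcon (by exact_mod_cast hq1)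
        omega
      have h3 : (a : ℝ) ≤ -1 := by exact_mod_cast (show a ≤ -1 by omega)
      have h4 : (0 : ℝ) ≤ b := by exact_mod_cast hb0
      rw [le_abs]; right; nlinarith
    · subst h
      exfalso
      rcases le_or_gt b 0 with h | h
      · have : b * convDen (k + 1) ≤ 0 := mul_nonpos_of_nonpos_of_nonneg h (by positivity)
        omega
      · have : (convDen (k + 1) : ℤ) ≤ b * convDen (k + 1) :=
          le_mul_of_one_le_left (by positivity) h
        omega
    · have hb0 : b ≤ 0 := by
        by_contra hcon
        push Not at hcon
        have h1 : 0 < a * convDen k := mul_pos h (by exact_mod_cast hq)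
        have h2 : (convDen (k + 1) : ℤ) ≤ b * convDen (k + 1) :=
          le_mul_of_one_le_left (by positivity) hcon
        omega
      have h3 : (1 : ℝ) ≤ a := by exact_mod_cast h
      have h4 : (b : ℝ) ≤ 0 := by exact_mod_cast hb0
      rw [le_abs]; left; nlinarith
  rw [hval, abs_mul, abs_mul, abs_pow, abs_neg, abs_of_pos goldenSlope_pos, abs_of_pos invGolden_pos]
  exact le_mul_of_one_le_right hη.le hcoef

/-- `φ² q_k + 1` bounds `q_{k+2}` for `k ≥ 1`; integrality covers `k = 0`. -/
lemma convDen_add_two_le (k L : ℕ) (hL : (1 + (1 + Real.sqrt 5) / 2) * convDen k < (L : ℝ)) :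
    convDen (k + 2) ≤ L + 1 := by
  rcases Nat.eq_zero_or_pos k with rfl | hk
  · have h0 : convDen 0 = 1 := rfl
    have h2 : convDen (0 + 2) = 4 := rfl
    rw [h0] at hL
    rw [h2]
    have : (2 : ℝ) < L := by push_cast at hL; linarith [sqrt_five_gt]
    have : 2 < L := by exact_mod_cast this
    omega
  · have hclosed : ∀ j : ℕ, (convDen (j + 2) : ℝ) - (1 + (1 + Real.sqrt 5) / 2) * convDen j =
        Real.sqrt 5 * invGolden * (-invGolden) ^ j := by
      intro j
      induction j using Nat.twoStepInduction with
      | zero =>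
        simp only [convDen, invGolden]
        norm_num [Nat.fib]
        nlinarith [sqrt_five_sq]
      | one =>
        rw [show convDen (1 + 2) = 7 from rfl, show convDen 1 = 3 from rfl]
        unfold invGolden
        push_cast
        linear_combination ((Real.sqrt 5 - 2) / 4) * sqrt_five_sq
      | more j ih1 ih2 =>
        have : (-invGolden) ^ (j + 2) = (-invGolden) ^ j + (-invGolden) ^ (j + 1) := by
          rw [pow_succ, pow_succ]
          linear_combination (-invGolden) ^ j * invGolden_sq
        rw [this]
        push_cast [convDen_add_two] at ih1 ih2 ⊢
        linear_combination ih1 + ih2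
    have hk' := hclosed k
    have hle : (-invGolden) ^ k ≤ invGolden * invGolden := by
      rcases Nat.even_or_odd k with h | h
      · rw [h.neg_pow, ← pow_two]
        have : 2 ≤ k := by obtain ⟨r, hr⟩ := h; omega
        exact pow_le_pow_of_le_one invGolden_pos.le invGolden_lt_one.le this
      · rw [h.neg_pow]
        have := pow_pos invGolden_pos k
        have := mul_pos invGolden_pos invGolden_pos
        linarith
    have hbound : Real.sqrt 5 * invGolden * (-invGolden) ^ k < 1 := by
      have hnum : Real.sqrt 5 * invGolden * (invGolden * invGolden) < 1 := by
        rw [invGolden_sq]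
        unfold invGolden
        nlinarith [sqrt_five_sq, sqrt_five_gt]
      have hpos : 0 < Real.sqrt 5 * invGolden :=
        mul_pos (by linarith [sqrt_five_gt]) invGolden_pos
      exact lt_of_le_of_lt (mul_le_mul_of_nonneg_left hle hpos.le) hnum
    have : (convDen (k + 2) : ℝ) < L + 1 := by linarith
    exact_mod_cast this.le

lemma onesBefore_le (i : ℕ) : (onesBefore i : ℝ) ≤ i * goldenSlope := Int.floor_le _

lemma lt_onesBefore (i : ℕ) : i * goldenSlope < onesBefore i + 1 := Int.lt_floor_add_one _

lemma onesBefore_eq {i : ℕ} {m : ℤ} (h0 : (m : ℝ) ≤ i * goldenSlope) (h1 : i * goldenSlope < m + 1) :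
    onesBefore i = m := Int.floor_eq_iff.2 ⟨h0, h1⟩

lemma onesBefore_mono : Monotone onesBefore := fun i j hij =>
  Int.floor_mono (mul_le_mul_of_nonneg_right (by exact_mod_cast hij) goldenSlope_pos.le)

lemma onesBefore_add_three (i : ℕ) : onesBefore (i + 3) ≤ onesBefore i + 1 := by
  have h1 := onesBefore_le (i + 3)
  have h2 := lt_onesBefore i
  have : (onesBefore (i + 3) : ℝ) < onesBefore i + 1 + 1 := by
    push_cast at h1
    linarith [three_goldenSlope_lt]
  have : onesBefore (i + 3) < onesBefore i + 1 + 1 := by exact_mod_cast this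
  omega

lemma onesBefore_succ (i : ℕ) :
    onesBefore (i + 1) = onesBefore i + if sturmianWord i then 1 else 0 := by
  have h1 := onesBefore_mono (show i ≤ i + 1 by omega)
  have h2 := onesBefore_mono (show i + 1 ≤ i + 3 by omega)
  have h3 := onesBefore_add_three i
  by_cases h : onesBefore (i + 1) = onesBefore i
  · simp [sturmianWord, h]
  · simp only [sturmianWord, ne_eq, h, not_false_eq_true, decide_true, if_true]
    omega

/-- A `p`-periodic stretch of the word is shorter than `(2 + φ) p`. -/
lemma sturmianWord_repetition (i₀ p L : ℕ) (hp : 0 < p)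
    (hper : ∀ j < L, sturmianWord (i₀ + j) = sturmianWord (i₀ + j + p)) :
    (L : ℝ) ≤ (1 + (1 + Real.sqrt 5) / 2) * p := by
  by_contra! hL
  have hconst : ∀ j ≤ L, onesBefore (i₀ + j + p) - onesBefore (i₀ + j) =
      onesBefore (i₀ + p) - onesBefore i₀ := by
    intro j
    induction j with
    | zero => simp
    | succ j ih =>
      intro hj
      have h1 := onesBefore_succ (i₀ + j)
      have h2 := onesBefore_succ (i₀ + j + p)
      rw [← hper j (by omega)] at h2
      have h3 := ih (by omega)
      rw [show i₀ + (j + 1) + p = i₀ + j + p + 1 by omega,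
        show i₀ + (j + 1) = i₀ + j + 1 by omega]
      omega
  obtain ⟨k, hk, hk1⟩ : ∃ k, convDen k ≤ p ∧ p < convDen (k + 1) := by
    have hex : ∃ k, p < convDen (k + 1) := ⟨p, lt_convDen_succ p⟩
    refine ⟨Nat.find hex, ?_, Nat.find_spec hex⟩
    rcases hf : Nat.find hex with _ | r
    · exact hp
    · exact not_lt.1 (Nat.find_min hex (show r < Nat.find hex by omega))
  have hwin : convDen (k + 2) ≤ L + 1 := by
    refine convDen_add_two_le k L (lt_of_le_of_lt ?_ hL)
    have : (convDen k : ℝ) ≤ p := by exact_mod_cast hk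
    have := Real.sqrt_nonneg 5
    gcongr
  have hη : 0 < goldenSlope * invGolden ^ k := mul_pos goldenSlope_pos (pow_pos invGolden_pos k)
  have hfl := onesBefore_le p
  have hfu := lt_onesBefore p
  have hlow := best_approximation k p hp hk1 (onesBefore p)
  have hupp := best_approximation k p hp hk1 (onesBefore p + 1)
  rw [abs_of_nonneg (by linarith)] at hlow
  rw [abs_of_nonpos (by push_cast; linarith)] at hupp
  push_cast at hupp
  have hone : goldenSlope * invGolden ^ k ≤ 1 := by linarith
  obtain ⟨i, hi, m, h0, h1⟩ := exists_rotation_mem k (i₀ * goldenSlope)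
  obtain ⟨j, hj, n, g0, g1⟩ := exists_rotation_mem k (i₀ * goldenSlope + goldenSlope * invGolden ^ k)
  have e1 : onesBefore (i₀ + i) = m :=
    onesBefore_eq (by push_cast; linarith) (by push_cast; linarith)
  have e2 : onesBefore (i₀ + i + p) = m + onesBefore p :=
    onesBefore_eq (by push_cast; linarith) (by push_cast; linarith)
  have e3 : onesBefore (i₀ + j) = n - 1 :=
    onesBefore_eq (by push_cast; linarith) (by push_cast; linarith)
  have e4 : onesBefore (i₀ + j + p) = n + onesBefore p :=
    onesBefore_eq (by push_cast; linarith) (by push_cast; linarith)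
  have c1 := hconst i (by omega)
  have c2 := hconst j (by omega)
  omega

lemma FactorN.getElem?_eq {α : Type*} {w : ℕ → α} {x : List α} (h : FactorN w x) :
    ∃ i, ∀ k < x.length, x[k]? = some (w (i + k)) := by
  obtain ⟨i, hi⟩ := h
  refine ⟨i, fun k hk => ?_⟩
  rw [hi]
  simp [hk]

lemma minPeriod_spec {α : Type*} {x : List α} (hx : x ≠ []) : HasPeriod x (minPeriod x) :=
  Nat.sInf_mem (s := {p | HasPeriod x p})
    ⟨x.length, List.length_pos_iff.2 hx, fun i hi => by omega⟩

/-- Three consecutive letters contain at most one `true`. -/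
lemma sturmianWord_sparse (i : ℕ) :
    ¬ (sturmianWord i = true ∧ sturmianWord (i + 1) = true) ∧
    ¬ (sturmianWord i = true ∧ sturmianWord (i + 2) = true) ∧
    ¬ (sturmianWord (i + 1) = true ∧ sturmianWord (i + 2) = true) := by
  have h0 := onesBefore_succ i
  have h1 := onesBefore_succ (i + 1)
  have h2 := onesBefore_succ (i + 2)
  have h3 := onesBefore_add_three i
  refine ⟨?_, ?_, ?_⟩ <;> rintro ⟨a, b⟩ <;> simp only [a, b, if_true] at h0 h1 h2 <;>
    
    simp only [add_assoc, Nat.reduceAdd] at h0 h1 h2 <;> split_ifs at h0 h1 h2 <;> omega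

theorem stmt7 :
    ∃ w : ℕ → Bool,
      (∀ x : List Bool, FactorN w x → x ≠ [] → expo x ≤ 2 + (1 + Real.sqrt 5) / 2) ∧
      ∃ F : Finset (List Bool), F.card ≤ 4 ∧
        ∀ x : List Bool, x ≠ [] → FactorN w x → FactorN w (comp x) → x ∈ F := by
  refine ⟨sturmianWord, ?_, {[false], [true], [false, true], [true, false]}, by decide, ?_⟩
  · intro x hfac hx
    obtain ⟨i, hi⟩ := hfac.getElem?_eq
    obtain ⟨hp, hper⟩ := minPeriod_spec hx
    have hrep := sturmianWord_repetition i (minPeriod x) (x.length - minPeriod x) hp (by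
      intro j hj
      have h := hper j (by omega)
      rw [hi j (by omega), hi (j + minPeriod x) (by omega)] at h
      simpa [add_assoc] using h)
    have hp' : (0 : ℝ) < minPeriod x := by exact_mod_cast hp
    have hsub : (x.length : ℝ) ≤ (x.length - minPeriod x : ℕ) + minPeriod x := by
      exact_mod_cast (show x.length ≤ x.length - minPeriod x + minPeriod x by omega)
    rw [expo, div_le_iff₀ hp']
    linarith
  · intro x hx hfac hcomp
    obtain ⟨i, hi⟩ := hfac.getElem?_eq
    obtain ⟨j, hj⟩ := hcomp.getElem?_eq
    have hsi := sturmianWord_sparse i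
    have hsj := sturmianWord_sparse j
    match x, hx with
    | [a], _ => cases a <;> simp
    | [a, b], _ =>
      have a0 := hi 0 (by simp)
      have a1 := hi 1 (by simp)
      have b0 := hj 0 (by simp [comp])
      have b1 := hj 1 (by simp [comp])
      simp [comp] at a0 a1 b0 b1
      rw [← a0, ← a1] at hsi
      generalize sturmianWord j = d, sturmianWord (j + 1) = e at b0 b1 hsj
      subst b0 b1
      cases d <;> cases e <;> simp at hsi hsj ⊢
    | a :: b :: c :: l, _ =>
      have a0 := hi 0 (by simp)
      have a1 := hi 1 (by simp)
      have a2 := hi 2 (by simp)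
      have b0 := hj 0 (by simp [comp])
      have b1 := hj 1 (by simp [comp])
      have b2 := hj 2 (by simp [comp])
      simp [comp] at a0 a1 a2 b0 b1 b2
      rw [← a0, ← a1, ← a2] at hsi
      generalize sturmianWord j = d, sturmianWord (j + 1) = e,
        sturmianWord (j + 2) = f at b0 b1 b2 hsj
      subst b0 b1 b2
      cases d <;> cases e <;> cases f <;> simp at hsi hsj
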